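/- arXiv:2201.12912 — 2 statements merged into one kernel-verified Lean document; each statement's English description precedes it below -/
import Mathlib

section
/- Let X be an infinite-dimensional complex Banach space, let A be a prime unital associative complex algebra, and let φ: B(X) → A be a bijective linear map such that φ(P)φ(Q) = D whenever PQ = C, where C is a fixed finite-rank bounded operator on X and D is a fixed element of A. Then α := φ(I) is an invertible element lying in the center of A, and there exists an algebra isomorphism Φ: B(X) → A such that φ(T) = α · Φ(T) for all T ∈ B(X). -/
section helpers

variable {X : Type*} [NormedAddCommGroup X] [NormedSpace ℂ X]

/-- Finite rank predicate. -/
def FinRk (f : X →L[ℂ] X) : Prop := FiniteDimensional ℂ (LinearMap.range (f : X →ₗ[ℂ] X))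

lemma FinRk.add {f g : X →L[ℂ] X} (hf : FinRk f) (hg : FinRk g) : FinRk (f + g) := by
  unfold FinRk at *
  have : LinearMap.range ((f + g : X →L[ℂ] X) : X →ₗ[ℂ] X) ≤
      LinearMap.range (f : X →ₗ[ℂ] X) ⊔ LinearMap.range (g : X →ₗ[ℂ] X) := by
    rintro _ ⟨x, rfl⟩
    exact Submodule.add_mem_sup ⟨x, rfl⟩ ⟨x, rfl⟩
  exact Submodule.finiteDimensional_of_le this

lemma FinRk.smulRight (l : X →L[ℂ] ℂ) (y : X) : FinRk (l.smulRight y) := by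
  unfold FinRk
  have : LinearMap.range ((l.smulRight y : X →L[ℂ] X) : X →ₗ[ℂ] X) ≤ Submodule.span ℂ {y} := by
    rintro _ ⟨x, rfl⟩
    exact Submodule.smul_mem _ _ (Submodule.mem_span_singleton_self y)
  exact Submodule.finiteDimensional_of_le this

lemma FinRk.zero : FinRk (0 : X →L[ℂ] X) := by
  have := FinRk.smulRight (0 : X →L[ℂ] ℂ) (0 : X)
  simpa using this

/-- A rank one idempotent orthogonal to a given finite rank idempotent. -/
lemma exists_orth (hX : ¬FiniteDimensional ℂ X) (f : X →L[ℂ] X) (hf : FinRk f) (hff : f * f = f) :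
    ∃ (m : X →L[ℂ] ℂ) (x : X), m x = 1 ∧ f * m.smulRight x = 0 ∧ m.smulRight x * f = 0 := by
  have hker : ∃ x, x ≠ 0 ∧ f x = 0 := by
    by_contra hcon
    push Not at hcon
    apply hX
    have hinj : Function.Injective (f : X →ₗ[ℂ] X).rangeRestrict := by
      rw [← LinearMap.ker_eq_bot, LinearMap.ker_rangeRestrict, LinearMap.ker_eq_bot']
      intro x hx
      by_contra h0
      exact hcon x h0 hx
    have := hf
    unfold FinRk at this
    exact FiniteDimensional.of_injective _ hinj
  obtain ⟨x, hx0, hfx⟩ := hker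
  obtain ⟨l, hl⟩ := SeparatingDual.exists_eq_one (R := ℂ) hx0
  refine ⟨l.comp (1 - f), x, ?_, ?_, ?_⟩
  · simp [hfx, hl]
  · ext z; simp [hfx]
  · ext z
    have : f (f z) = f z := congrArg (fun g : X →L[ℂ] X => g z) hff
    simp [this]

lemma exists_factor (hX : ¬FiniteDimensional ℂ X) (f : X →L[ℂ] X) (hf : FinRk f) (hff : f * f = f)
    {ι : Type*} (s : Finset ι) (l : ι → X →L[ℂ] ℂ) (y : ι → X) :
    ∃ p v w : X →L[ℂ] X, FinRk p ∧ p * p = p ∧ p * f = 0 ∧ f * p = 0 ∧ v * p = v ∧ p * w = w ∧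
      v * w = ∑ i ∈ s, (l i).smulRight (y i) := by
  classical
  induction s using Finset.induction_on with
  | empty => exact ⟨0, 0, 0, FinRk.zero, by simp⟩
  | insert i s hi ih =>
    obtain ⟨p, v, w, hp, hpp, hpf, hfp, hvp, hpw, hvw⟩ := ih
    obtain ⟨m, x, hmx, h1, h2⟩ := exists_orth hX (f + p) (hf.add hp)
      (by rw [add_mul, mul_add, mul_add, hff, hfp, hpf, hpp]; abel)
    set g := m.smulRight x with hg
    have hgg : g * g = g := by ext z; simp [hg, hmx]
    have hfg : f * g = 0 := by
      have := congrArg (fun t => f * t) h1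
      simpa [← mul_assoc, mul_add, hff, hfp] using this
    have hpg : p * g = 0 := by
      have := congrArg (fun t => p * t) h1
      simpa [← mul_assoc, mul_add, hpp, hpf] using this
    have hgf : g * f = 0 := by
      have := congrArg (fun t => t * f) h2
      simpa [mul_assoc, add_mul, hff, hpf] using this
    have hgp : g * p = 0 := by
      have := congrArg (fun t => t * p) h2
      simpa [mul_assoc, add_mul, hpp, hfp] using this
    have hv2 : m.smulRight (y i) * g = m.smulRight (y i) := by ext z; simp [hg, hmx]
    have hw2 : g * (l i).smulRight x = (l i).smulRight x := by ext z; simp [hg, hmx]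
    have hvw2 : m.smulRight (y i) * (l i).smulRight x = (l i).smulRight (y i) := by
      ext z; simp [hmx]
    generalize m.smulRight (y i) = v2 at *
    generalize (l i).smulRight x = w2 at *
    have e1 : v2 * p = 0 := by rw [← hv2, mul_assoc, hgp, mul_zero]
    have e2 : v * g = 0 := by rw [← hvp, mul_assoc, hpg, mul_zero]
    have e3 : p * w2 = 0 := by rw [← hw2, ← mul_assoc, hpg, zero_mul]
    have e4 : g * w = 0 := by rw [← hpw, ← mul_assoc, hgp, zero_mul]
    have e5 : v * w2 = 0 := by rw [← hw2, ← mul_assoc, e2, zero_mul]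
    have e6 : v2 * w = 0 := by rw [← hpw, ← mul_assoc, e1, zero_mul]
    refine ⟨p + g, v + v2, w + w2, hp.add (FinRk.smulRight m x), ?_, ?_, ?_, ?_, ?_, ?_⟩
    · simp only [add_mul, mul_add, hpp, hgp, hpg, hgg]; abel
    · rw [add_mul, hpf, hgf, add_zero]
    · rw [mul_add, hfp, hfg, add_zero]
    · simp only [add_mul, mul_add, hvp, e2, e1, hv2]; abel
    · simp only [add_mul, mul_add, hpw, e3, e4, hw2]; abel
    · rw [Finset.sum_insert hi, ← hvw, ← hvw2]
      simp only [add_mul, mul_add, e5, e6]; abel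

lemma finRk_eq_sum (C : X →L[ℂ] X) (hC : FinRk C) :
    ∃ (n : ℕ) (l : Fin n → X →L[ℂ] ℂ) (y : Fin n → X), C = ∑ i, (l i).smulRight (y i) := by
  unfold FinRk at hC
  let b := Module.finBasis ℂ (LinearMap.range (C : X →ₗ[ℂ] X))
  have hm : ∀ x, C x ∈ LinearMap.range (C : X →ₗ[ℂ] X) := fun x => ⟨x, rfl⟩
  refine ⟨_, fun i => (LinearMap.toContinuousLinearMap (b.coord i)).comp
    (C.codRestrict (LinearMap.range (C : X →ₗ[ℂ] X)) hm), fun i => b i, ?_⟩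
  ext x
  have h1 := congrArg Subtype.val (b.sum_repr ⟨C x, hm x⟩)
  rw [Submodule.coe_sum] at h1
  rw [ContinuousLinearMap.sum_apply]
  exact h1.symm

variable {A : Type*} [Ring A] [Algebra ℂ A]

lemma idem_step (hX : ¬FiniteDimensional ℂ X)
    (φ : (X →L[ℂ] X) →ₗ[ℂ] A) (C : X →L[ℂ] X) (D : A) (hC : FinRk C)
    (h : ∀ P Q : X →L[ℂ] X, P * Q = C → φ P * φ Q = D)
    (e : X →L[ℂ] X) (he : FinRk e) (hee : e * e = e) (a c : X →L[ℂ] X) :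
    φ (a * e) * φ c = φ a * φ (e * c) := by
  obtain ⟨n, l, y, hCs⟩ := finRk_eq_sum C hC
  obtain ⟨p, v, w, hp, hpp, hpe, hep, hvp, hpw, hvw⟩ := exists_factor hX e he hee Finset.univ l y
  obtain ⟨q, v', w', hq, hqq, hqe, heq, hvq, hqw, hvw'⟩ := exists_factor hX (e + p) (he.add hp)
      (by rw [add_mul, mul_add, mul_add, hee, hep, hpe, hpp]; abel) Finset.univ l y
  rw [← hCs] at hvw hvw'
  have hpq : p * q = 0 := by
    have := congrArg (fun t => p * t) heq
    simpa [← mul_assoc, add_mul, mul_add, hpp, hpe] using this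
  have hqp : q * p = 0 := by
    have := congrArg (fun t => t * p) hqe
    simpa [mul_assoc, add_mul, mul_add, hpp, hep] using this
  have heq' : e * q = 0 := by simpa [add_mul, hpq] using heq
  have hqe' : q * e = 0 := by simpa [mul_add, hqp] using hqe
  have L : ∀ P R Q, P * R = C → P * Q = 0 → φ P * φ Q = 0 := by
    intro P R Q h1 h2
    have e1 := h P R h1
    have e2 := h P (R + Q) (by rw [mul_add, h1, h2, add_zero])
    rw [map_add, mul_add, e1] at e2
    simpa using e2
  have R : ∀ P R Q, R * Q = C → P * Q = 0 → φ P * φ Q = 0 := by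
    intro P R Q h1 h2
    have e1 := h R Q h1
    have e2 := h (R + P) Q (by rw [add_mul, h1, h2, add_zero])
    rw [map_add, add_mul, e1] at e2
    simpa using e2
  have L1 : ∀ p v w : X →L[ℂ] X, p * p = p → v * p = v → p * w = w → v * w = C →
      ∀ P Q, p * Q = 0 → P * Q = 0 → φ (P * (1 - p)) * φ Q = 0 := by
    intro p v w hpp hvp hpw hvw P Q hpQ hPQ
    have z : v * Q = 0 := by rw [← hvp, mul_assoc, hpQ, mul_zero]
    have e1 := L v w Q hvw z
    have e2 := L (P * (1 - p) + v) w Q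
      (by rw [add_mul, hvw, mul_assoc, sub_mul, one_mul, hpw]; simp)
      (by rw [add_mul, z, mul_assoc, sub_mul, one_mul, hpQ]; simp [hPQ])
    rw [map_add, add_mul, e1] at e2
    simpa using e2
  have R1 : ∀ p v w : X →L[ℂ] X, p * p = p → v * p = v → p * w = w → v * w = C →
      ∀ P Q, P * p = 0 → P * Q = 0 → φ P * φ ((1 - p) * Q) = 0 := by
    intro p v w hpp hvp hpw hvw P Q hPp hPQ
    have z : P * w = 0 := by rw [← hpw, ← mul_assoc, hPp, zero_mul]
    have e1 := R P v w hvw z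
    have e2 := R P v ((1 - p) * Q + w)
      (by rw [mul_add, hvw, ← mul_assoc, mul_sub, mul_one, hvp]; simp)
      (by rw [mul_add, z, ← mul_assoc, mul_sub, mul_one, hPp]; simp [hPQ])
    rw [map_add, mul_add, e1] at e2
    simpa using e2
  have L2 : ∀ P Q, p * Q = 0 → q * Q = 0 → P * Q = 0 → φ P * φ Q = 0 := by
    intro P Q h1 h2 h3
    have e1 := L1 p v w hpp hvp hpw hvw P Q h1 h3
    have e2 := L1 q v' w' hqq hvq hqw hvw' (P * p) Q h2 (by rw [mul_assoc, h1, mul_zero])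
    have : P = P * (1 - p) + P * p * (1 - q) := by
      simp [mul_sub, mul_assoc, hpq]
    rw [this, map_add, add_mul, e1, e2, add_zero]
  have R2 : ∀ P Q, P * p = 0 → P * q = 0 → P * Q = 0 → φ P * φ Q = 0 := by
    intro P Q h1 h2 h3
    have e1 := R1 p v w hpp hvp hpw hvw P Q h1 h3
    have e2 := R1 q v' w' hqq hvq hqw hvw' P (p * Q) h2 (by rw [← mul_assoc, h1, zero_mul])
    have : Q = (1 - p) * Q + (1 - q) * (p * Q) := by
      simp [sub_mul, ← mul_assoc, hqp]
    rw [this, map_add, mul_add, e1, e2, add_zero]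
  have k1 : φ (a * e) * φ (c - e * c) = 0 := by
    apply R2
    · rw [mul_assoc, hep, mul_zero]
    · rw [mul_assoc, heq', mul_zero]
    · rw [mul_sub, mul_assoc, mul_assoc, ← mul_assoc e e, hee, sub_self]
  have k2 : φ (a - a * e) * φ (e * c) = 0 := by
    apply L2
    · rw [← mul_assoc, hpe, zero_mul]
    · rw [← mul_assoc, hqe', zero_mul]
    · rw [sub_mul, mul_assoc, ← mul_assoc e e, hee, sub_self]
  rw [map_sub, mul_sub, sub_eq_zero] at k1
  rw [map_sub, sub_mul, sub_eq_zero] at k2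
  rw [k1, k2]

lemma rankOne_step (hX : ¬FiniteDimensional ℂ X)
    (φ : (X →L[ℂ] X) →ₗ[ℂ] A) (C : X →L[ℂ] X) (D : A) (hC : FinRk C)
    (h : ∀ P Q : X →L[ℂ] X, P * Q = C → φ P * φ Q = D)
    (l : X →L[ℂ] ℂ) (y : X) (a c : X →L[ℂ] X) :
    φ (a * l.smulRight y) * φ c = φ a * φ (l.smulRight y * c) := by
  have key : ∀ z : X, l z = 1 →
      φ (a * l.smulRight z) * φ c = φ a * φ (l.smulRight z * c) := fun z hz =>
    idem_step hX φ C D hC h _ (FinRk.smulRight l z) (by ext t; simp [hz]) a c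
  by_cases hl : l = 0
  · subst hl; simp
  obtain ⟨z, hz⟩ : ∃ z, l z = 1 := by
    obtain ⟨x, hx⟩ : ∃ x, l x ≠ 0 := by
      by_contra hcon
      push Not at hcon
      exact hl (ContinuousLinearMap.ext hcon)
    exact ⟨(l x)⁻¹ • x, by simp [hx]⟩
  have e0 := key z hz
  have e1 := key (y + (1 - l y) • z) (by simp [hz])
  have : l.smulRight y = l.smulRight (y + (1 - l y) • z) - (1 - l y) • l.smulRight z := by
    ext t; simp [smul_smul, mul_comm]
  rw [this]
  simp only [mul_sub, sub_mul, map_sub, mul_smul_comm, smul_mul_assoc, map_smul, e0, e1]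

end helpers

/-- Theorem 2.2. Let `A` be a prime unital complex algebra and `X` an
infinite-dimensional complex Banach space. If `φ : B(X) → A` is a bijective linear map such
that `φ P * φ Q = D` whenever `P * Q = C`, where `C` is a finite-rank operator, then
`α := φ I` is an invertible central element of `A` and there is an algebra isomorphism
`Φ : B(X) ≃ₐ A` with `φ T = α * Φ T` for all `T`. -/
theorem stmt1 {X : Type*} [NormedAddCommGroup X] [NormedSpace ℂ X] [CompleteSpace X]
    (hX : ¬FiniteDimensional ℂ X)
    {A : Type*} [Ring A] [Algebra ℂ A]
    (hprime : ∀ a b : A, (∀ r : A, a * r * b = 0) → a = 0 ∨ b = 0)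
    (φ : (X →L[ℂ] X) →ₗ[ℂ] A) (hφ : Function.Bijective φ)
    (C : X →L[ℂ] X) (D : A)
    (hCfin : FiniteDimensional ℂ (LinearMap.range (C : X →ₗ[ℂ] X)))
    (h : ∀ P Q : X →L[ℂ] X, P * Q = C → φ P * φ Q = D) :
    IsUnit (φ 1) ∧ φ 1 ∈ Set.center A ∧
      ∃ Φ : (X →L[ℂ] X) ≃ₐ[ℂ] A, ∀ T : X →L[ℂ] X, φ T = φ 1 * Φ T := by
  have key := rankOne_step hX φ C D hCfin h
  have hl : ∀ (l : X →L[ℂ] ℂ) y c, φ (l.smulRight y) * φ c = φ 1 * φ (l.smulRight y * c) := by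
    intro l y c; simpa using key l y 1 c
  have hr : ∀ (l : X →L[ℂ] ℂ) y a, φ (l.smulRight y * a) = φ ((l.comp a).smulRight y) := by
    intro l y a; congr 1
  have hcomm : ∀ (l : X →L[ℂ] ℂ) y, φ (l.smulRight y) * φ 1 = φ 1 * φ (l.smulRight y) := by
    intro l y; simpa using key l y 1 1
  obtain ⟨x, hx⟩ : ∃ x : X, x ≠ 0 := by
    by_contra hcon
    push Not at hcon
    have : Subsingleton X := ⟨fun a b => by rw [hcon a, hcon b]⟩
    exact hX inferInstance
  obtain ⟨l₀, hl₀⟩ := SeparatingDual.exists_eq_one (R := ℂ) hx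
  have hne : φ (l₀.smulRight x) ≠ 0 := by
    intro h0
    have h1 := hφ.1 (h0.trans (map_zero φ).symm)
    have h2 := congrArg (fun g : X →L[ℂ] X => g x) h1
    simp [hl₀, hx] at h2
  have hann : ∀ t : A, (∀ (l : X →L[ℂ] ℂ) y, φ (l.smulRight y) * t = 0) → t = 0 := by
    intro t ht
    refine (hprime (φ (l₀.smulRight x)) t ?_).resolve_left hne
    intro r
    obtain ⟨c, rfl⟩ := hφ.2 r
    rw [hl, hr, mul_assoc, ht, mul_zero]
  have hmul : ∀ a b, φ 1 * φ (a * b) = φ a * φ b := by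
    intro a b
    rw [← sub_eq_zero]
    apply hann
    intro l y
    have e1 : φ (l.smulRight y) * φ (a * b) = φ ((l.comp a).smulRight y) * φ b := by
      rw [hl l y, hl (l.comp a) y]
      congr 1
    rw [mul_sub, sub_eq_zero, ← mul_assoc, hcomm, mul_assoc, e1, ← mul_assoc, ← hr, ← hl,
      mul_assoc]
  have hcen : ∀ r, φ 1 * r = r * φ 1 := by
    intro r
    obtain ⟨a, rfl⟩ := hφ.2 r
    simpa using hmul a 1
  obtain ⟨u, hu⟩ := hφ.2 1
  have hinv : φ 1 * φ (u * u) = 1 := by rw [hmul, hu, mul_one]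
  have hinv' : φ (u * u) * φ 1 = 1 := by rw [← hcen, hinv]
  refine ⟨⟨⟨φ 1, φ (u * u), hinv, hinv'⟩, rfl⟩, ?_, ?_⟩
  · rw [Semigroup.mem_center_iff]
    intro g
    exact (hcen g).symm
  set β := φ (u * u) with hβ
  have hβcen : ∀ r, β * r = r * β := by
    intro r
    calc β * r = β * r * (φ 1 * β) := by rw [hinv, mul_one]
      _ = β * (r * φ 1) * β := by simp only [mul_assoc]
      _ = β * φ 1 * r * β := by rw [← hcen]; simp only [mul_assoc]
      _ = r * β := by rw [hinv', one_mul]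
  let Ψ : (X →L[ℂ] X) →ₐ[ℂ] A := AlgHom.ofLinearMap ((LinearMap.mulLeft ℂ β).comp φ)
    (by simpa using hinv') (by
      intro a b
      simp only [LinearMap.comp_apply, LinearMap.mulLeft_apply]
      calc β * φ (a * b) = β * (β * φ 1) * φ (a * b) := by rw [hinv', mul_one]
        _ = β * β * (φ 1 * φ (a * b)) := by simp only [mul_assoc]
        _ = β * (β * φ a) * φ b := by rw [hmul]; simp only [mul_assoc]
        _ = β * (φ a * β) * φ b := by rw [← hβcen (φ a)]
        _ = β * φ a * (β * φ b) := by simp only [mul_assoc])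
  have hΨ : ∀ T, Ψ T = β * φ T := fun T => rfl
  have hT : ∀ T, φ T = φ 1 * Ψ T := fun T => by rw [hΨ, ← mul_assoc, hinv, one_mul]
  refine ⟨AlgEquiv.ofBijective Ψ ⟨?_, ?_⟩, fun T => hT T⟩
  · intro a b hab
    apply hφ.1
    rw [hT a, hT b, hab]
  · intro r
    obtain ⟨a, ha⟩ := hφ.2 (φ 1 * r)
    exact ⟨a, by rw [hΨ, ha, ← mul_assoc, hinv', one_mul]⟩
end

section
/- Let X be an infinite-dimensional complex Banach space, let S be a unital subalgebra of B(X) containing all finite-rank operators, and let A be a prime unital associative complex algebra. If φ: S → A is a bijective linear map such that φ(P)φ(Q) = D whenever P, Q ∈ S satisfy PQ = C, where C ∈ S is a fixed finite-rank operator and D ∈ A is fixed, then there exist an invertible central element α of A and an algebra homomorphism Φ: S → A such that φ(T) = α · Φ(T) for all T ∈ S. -/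
set_option synthInstance.maxHeartbeats 1000000
set_option maxHeartbeats 1000000

/-- Finite rank. -/
def FRk {X : Type*} [NormedAddCommGroup X] [NormedSpace ℂ X] (T : X →L[ℂ] X) : Prop :=
  FiniteDimensional ℂ (LinearMap.range (T : X →ₗ[ℂ] X))

theorem FRk.of_factor {X : Type*} [NormedAddCommGroup X] [NormedSpace ℂ X]
    {V : Type*} [NormedAddCommGroup V] [NormedSpace ℂ V] [FiniteDimensional ℂ V]
    (U : V →L[ℂ] X) (L : X →L[ℂ] V) : FRk (U.comp L) := by
  unfold FRk
  refine Submodule.finiteDimensional_of_le (S₂ := LinearMap.range (U : V →ₗ[ℂ] X)) ?_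
  rintro _ ⟨x, rfl⟩
  exact ⟨L x, rfl⟩

theorem FRk.add {X : Type*} [NormedAddCommGroup X] [NormedSpace ℂ X] {T R : X →L[ℂ] X}
    (hT : FRk T) (hR : FRk R) : FRk (T + R) := by
  unfold FRk at *
  refine Submodule.finiteDimensional_of_le
    (S₂ := LinearMap.range (T : X →ₗ[ℂ] X) ⊔ LinearMap.range (R : X →ₗ[ℂ] X)) ?_
  rintro _ ⟨x, rfl⟩
  exact Submodule.add_mem_sup ⟨x, rfl⟩ ⟨x, rfl⟩

theorem exists_embed {X : Type*} [NormedAddCommGroup X] [NormedSpace ℂ X]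
    (hX : ¬FiniteDimensional ℂ X) {V : Type*} [NormedAddCommGroup V] [NormedSpace ℂ V]
    [FiniteDimensional ℂ V] (E : X →L[ℂ] X) (hE : FRk E) (hEE : E * E = E) :
    ∃ (U : V →L[ℂ] X) (L : X →L[ℂ] V), (∀ v, L (U v) = v) ∧ (∀ v, E (U v) = 0) ∧
      ∀ x, L (E x) = 0 := by
  have hK : ¬ FiniteDimensional ℂ (LinearMap.ker (E : X →ₗ[ℂ] X)) := by
    intro hK
    apply hX
    have := hE
    unfold FRk at this
    have e := (E : X →ₗ[ℂ] X).quotKerEquivRange.symm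
    have : FiniteDimensional ℂ (X ⧸ LinearMap.ker (E : X →ₗ[ℂ] X)) := e.finiteDimensional
    exact Module.Finite.of_submodule_quotient (LinearMap.ker (E : X →ₗ[ℂ] X))
  have hr : ((Module.finrank ℂ V : ℕ) : Cardinal) ≤ Module.rank ℂ (LinearMap.ker (E : X →ₗ[ℂ] X)) := by
    refine (Cardinal.natCast_lt_aleph0).le.trans ?_
    by_contra hlt
    exact hK (Module.rank_lt_aleph0_iff.1 (not_le.1 hlt))
  obtain ⟨u, hu⟩ : ∃ u : V →ₗ[ℂ] (LinearMap.ker (E : X →ₗ[ℂ] X)), Function.Injective u := by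
    obtain ⟨s, hs, hsl⟩ := exists_finset_linearIndependent_of_le_rank
      (R := ℂ) (M := LinearMap.ker (E : X →ₗ[ℂ] X)) (n := Module.finrank ℂ V)
      hr
    let b := Module.finBasisOfFinrankEq ℂ V hs.symm
    let e : Fin s.card ≃ s := s.equivFin.symm
    refine ⟨b.constr ℂ (fun i => ((e i : s) : LinearMap.ker (E : X →ₗ[ℂ] X))), ?_⟩
    have := hsl.comp e e.injective
    rw [← LinearMap.ker_eq_bot]
    exact LinearMap.ker_eq_bot.2 (b.injective_constr_of_linearIndependent this)
  let U0 : V →ₗ[ℂ] X := (LinearMap.ker (E : X →ₗ[ℂ] X)).subtype ∘ₗ u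
  have hU0 : Function.Injective U0 := Subtype.val_injective.comp hu
  let e := LinearEquiv.ofInjective U0 hU0
  obtain ⟨p, hp⟩ := Submodule.ClosedComplemented.of_finiteDimensional (LinearMap.range U0)
  let L0 : X →L[ℂ] V := (LinearMap.toContinuousLinearMap (e.symm : LinearMap.range U0 →ₗ[ℂ] V)).comp p
  have hEU : ∀ v, E (U0 v) = 0 := fun v => (u v).2
  have hEE' : ∀ x, E (E x) = E x := fun x => congrArg (fun T : X →L[ℂ] X => T x) hEE
  refine ⟨LinearMap.toContinuousLinearMap U0, L0.comp (1 - E), ?_, hEU, ?_⟩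
  · intro v
    have h1 : p (U0 v) = e v := by
      have := hp (e v)
      exact this
    simp [L0, hEU, h1]
  · intro x
    simp [hEE']

theorem ortho {X : Type*} [NormedAddCommGroup X] [NormedSpace ℂ X]
    (hX : ¬FiniteDimensional ℂ X)
    (S : Subalgebra ℂ (X →L[ℂ] X))
    (hS : ∀ T : X →L[ℂ] X, FRk T → T ∈ S) (C : S) (hC : FRk (C : X →L[ℂ] X))
    (E : S) (hE : FRk (E : X →L[ℂ] X)) (hEE : E * E = E) :
    ∃ G P Q : S, FRk (G : X →L[ℂ] X) ∧ E * G = 0 ∧ G * E = 0 ∧ G * G = G ∧ P * Q = C ∧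
      P * G = P ∧ G * Q = Q := by
  have hC' := hC
  unfold FRk at hC'
  obtain ⟨U, L, h1, h2, h3⟩ := exists_embed hX
    (V := LinearMap.range ((C : X →L[ℂ] X) : X →ₗ[ℂ] X)) (E : X →L[ℂ] X) hE
      (congrArg Subtype.val hEE)
  let c : X →L[ℂ] (LinearMap.range ((C : X →L[ℂ] X) : X →ₗ[ℂ] X)) :=
    (C : X →L[ℂ] X).codRestrict _ (fun x => ⟨x, rfl⟩)
  let i : (LinearMap.range ((C : X →L[ℂ] X) : X →ₗ[ℂ] X)) →L[ℂ] X := Submodule.subtypeL _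
  have hc : ∀ x, ((c x : LinearMap.range ((C : X →L[ℂ] X) : X →ₗ[ℂ] X)) : X) =
    (C : X →L[ℂ] X) x := fun x => rfl
  refine ⟨⟨U.comp L, hS _ (FRk.of_factor _ _)⟩, ⟨i.comp L, hS _ (FRk.of_factor _ _)⟩,
    ⟨U.comp c, hS _ (FRk.of_factor _ _)⟩, FRk.of_factor _ _, ?_, ?_, ?_, ?_, ?_, ?_⟩ <;>
  · apply Subtype.ext
    ext x
    simp [h1, h2, h3, i, hc]

/-- basic zero product lemma -/
theorem zp_basic {R A : Type*} [Ring R] [Algebra ℂ R] [Ring A] [Algebra ℂ A] (φ : R →ₗ[ℂ] A)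
    (C : R) (D : A) (h : ∀ P Q : R, P * Q = C → φ P * φ Q = D)
    {G P Q : R} (hPQ : P * Q = C) (hP : P * G = P) (hQ : G * Q = Q)
    {P' Q' : R} (h0 : P' * Q' = 0) (h1 : P' * G = 0) (h2 : G * Q' = 0) :
    φ P' * φ Q' = 0 := by
  have e1 : P' * Q = 0 := by rw [← hQ, ← mul_assoc, h1, zero_mul]
  have e2 : P * Q' = 0 := by rw [← hP, mul_assoc, h2, mul_zero]
  have a1 := h P Q hPQ
  have a2 := h (P + P') Q (by rw [add_mul, e1, hPQ, add_zero])
  have a3 := h P (Q + Q') (by rw [mul_add, e2, hPQ, add_zero])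
  have a4 := h (P + P') (Q + Q') (by simp [mul_add, add_mul, e1, e2, hPQ, h0])
  simp only [map_add, add_mul, mul_add, a1] at a2 a3 a4
  have b2 : φ P' * φ Q = 0 := by simpa using a2
  have b3 : φ P * φ Q' = 0 := by simpa using a3
  simpa [b2, b3] using a4

theorem zp_idem {X : Type*} [NormedAddCommGroup X] [NormedSpace ℂ X]
    (hX : ¬FiniteDimensional ℂ X)
    (S : Subalgebra ℂ (X →L[ℂ] X))
    (hS : ∀ T : X →L[ℂ] X, FRk T → T ∈ S) (C : S) (hC : FRk (C : X →L[ℂ] X))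
    {A : Type*} [Ring A] [Algebra ℂ A] (φ : S →ₗ[ℂ] A) (D : A)
    (h : ∀ P Q : S, P * Q = C → φ P * φ Q = D)
    (E : S) (hE : FRk (E : X →L[ℂ] X)) (hEE : E * E = E) (T R : S) :
    φ (T * E) * φ R = φ T * φ (E * R) := by
  obtain ⟨G, P, Q, hG, hEG, hGE, hGG, hPQ, hP, hQ⟩ := ortho hX S hS C hC E hE hEE
  obtain ⟨G', P', Q', hG', hEG', hGE', hGG', hPQ', hP', hQ'⟩ := ortho hX S hS C hC (E + G)
    (hE.add hG) (by simp [mul_add, add_mul, hEE, hEG, hGE, hGG])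
  have c1 : E * G' = 0 := by
    have : E * ((E + G) * G') = 0 := by rw [hEG', mul_zero]
    rwa [← mul_assoc, mul_add, hEE, hEG, add_zero] at this
  have c2 : G * G' = 0 := by
    have : G * ((E + G) * G') = 0 := by rw [hEG', mul_zero]
    rwa [← mul_assoc, mul_add, hGG, hGE, zero_add] at this
  have c3 : G' * E = 0 := by
    have : (G' * (E + G)) * E = 0 := by rw [hGE', zero_mul]
    rwa [mul_assoc, add_mul, hEE, hGE, add_zero] at this
  have c4 : G' * G = 0 := by
    have : (G' * (E + G)) * G = 0 := by rw [hGE', zero_mul]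
    rwa [mul_assoc, add_mul, hGG, hEG, zero_add] at this
  have t1 : φ (T * E) * φ ((1 - G - E) * R) = 0 := by
    refine zp_basic φ C D h hPQ hP hQ ?_ ?_ ?_
    · rw [mul_assoc, ← mul_assoc E]; simp [mul_sub, hEE, hEG]
    · rw [mul_assoc, hEG, mul_zero]
    · rw [← mul_assoc]; simp [mul_sub, hGG, hGE]
  have t2 : φ (T * E) * φ (G * R) = 0 := by
    refine zp_basic φ C D h hPQ' hP' hQ' ?_ ?_ ?_
    · rw [mul_assoc, ← mul_assoc E]; simp [hEG]
    · rw [mul_assoc, c1, mul_zero]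
    · rw [← mul_assoc, c4, zero_mul]
  have t3 : φ (T * (1 - G - E)) * φ (E * R) = 0 := by
    refine zp_basic φ C D h hPQ hP hQ ?_ ?_ ?_
    · rw [mul_assoc, ← mul_assoc _ E]; simp [sub_mul, hEE, hGE]
    · rw [mul_assoc]; simp [sub_mul, hGG, hEG]
    · rw [← mul_assoc, hGE, zero_mul]
  have t4 : φ (T * G) * φ (E * R) = 0 := by
    refine zp_basic φ C D h hPQ' hP' hQ' ?_ ?_ ?_
    · rw [mul_assoc, ← mul_assoc _ E]; simp [hGE]
    · rw [mul_assoc, c2, mul_zero]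
    · rw [← mul_assoc, c3, zero_mul]
  have s1 : φ (T * E) * φ R = φ (T * E) * φ (E * R) := by
    have : R = (1 - G - E) * R + G * R + E * R := by
      rw [sub_mul, sub_mul, one_mul]; abel
    conv_lhs => rw [this]
    rw [map_add, map_add, mul_add, mul_add, t1, t2]; simp
  have s2 : φ T * φ (E * R) = φ (T * E) * φ (E * R) := by
    have : T = T * (1 - G - E) + T * G + T * E := by
      rw [mul_sub, mul_sub, mul_one]; abel
    conv_lhs => rw [this]
    rw [map_add, map_add, add_mul, add_mul, t3, t4]; simp
  rw [s1, s2]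

theorem FRk_rankOne {X : Type*} [NormedAddCommGroup X] [NormedSpace ℂ X] (f : X →L[ℂ] ℂ) (x : X) :
    FRk (f.smulRight x) := by
  have : f.smulRight x = ((1 : ℂ →L[ℂ] ℂ).smulRight x).comp f := by ext; simp
  rw [this]
  exact FRk.of_factor _ _

/-- rank one element of `S` -/
noncomputable def rk1 {X : Type*} [NormedAddCommGroup X] [NormedSpace ℂ X] {S : Subalgebra ℂ (X →L[ℂ] X)}
    (hS : ∀ T : X →L[ℂ] X, FRk T → T ∈ S) (f : X →L[ℂ] ℂ) (x : X) : S :=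
  ⟨f.smulRight x, hS _ (FRk_rankOne f x)⟩

theorem zp_rk1 {X : Type*} [NormedAddCommGroup X] [NormedSpace ℂ X]
    (hX : ¬FiniteDimensional ℂ X)
    (S : Subalgebra ℂ (X →L[ℂ] X))
    (hS : ∀ T : X →L[ℂ] X, FRk T → T ∈ S) (C : S) (hC : FRk (C : X →L[ℂ] X))
    {A : Type*} [Ring A] [Algebra ℂ A] (φ : S →ₗ[ℂ] A) (D : A)
    (h : ∀ P Q : S, P * Q = C → φ P * φ Q = D)
    (f : X →L[ℂ] ℂ) (x : X) (T R : S) :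
    φ (T * rk1 hS f x) * φ R = φ T * φ (rk1 hS f x * R) := by
  have key : ∀ x, f x ≠ 0 → φ (T * rk1 hS f x) * φ R = φ T * φ (rk1 hS f x * R) := by
    intro x hx
    have e : rk1 hS f x = f x • rk1 hS ((f x)⁻¹ • f) x := by
      apply Subtype.ext; ext y; simp [rk1, smul_smul, hx]
    have := zp_idem hX S hS C hC φ D h (rk1 hS ((f x)⁻¹ • f) x) (FRk_rankOne _ _)
      (by apply Subtype.ext; ext y; simp [rk1, smul_smul, hx]) T R
    rw [e, mul_smul_comm, smul_mul_assoc, map_smul, map_smul, smul_mul_assoc, mul_smul_comm, this]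
  by_cases hx : f x = 0
  · by_cases hf : f = 0
    · have : rk1 hS f x = 0 := by apply Subtype.ext; ext y; simp [rk1, hf]
      simp [this]
    · obtain ⟨y, hy⟩ : ∃ y, f y ≠ 0 := by
        by_contra! hcon
        exact hf (by ext y; simp [hcon])
      have e : rk1 hS f x = rk1 hS f (x + y) - rk1 hS f y := by
        apply Subtype.ext; ext z; simp [rk1]
      have k1 := key (x + y) (by simpa [hx] using hy)
      have k2 := key y hy
      rw [e, mul_sub, sub_mul, map_sub, map_sub, mul_sub, sub_mul, k1, k2]
  · exact key x hx

/-- Corollary 2.3. Let `S` be a unital subalgebra of `B(X)` containing all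
finite-rank operators and `A` a prime unital complex algebra. If `φ : S → A` is a bijective
linear map with `φ P * φ Q = D` whenever `P * Q = C`, where `C ∈ S` is a fixed finite-rank
operator, then `φ` is an invertible central multiple of an algebra homomorphism. -/
theorem stmt3 {X : Type*} [NormedAddCommGroup X] [NormedSpace ℂ X] [CompleteSpace X]
    (hX : ¬FiniteDimensional ℂ X)
    (S : Subalgebra ℂ (X →L[ℂ] X))
    (hS : ∀ T : X →L[ℂ] X, FiniteDimensional ℂ (LinearMap.range (T : X →ₗ[ℂ] X)) → T ∈ S)
    {A : Type*} [Ring A] [Algebra ℂ A]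
    (hprime : ∀ a b : A, (∀ r : A, a * r * b = 0) → a = 0 ∨ b = 0)
    (φ : S →ₗ[ℂ] A) (hφ : Function.Bijective φ)
    (C : S) (D : A)
    (hCfin : FiniteDimensional ℂ (LinearMap.range ((C : X →L[ℂ] X) : X →ₗ[ℂ] X)))
    (h : ∀ P Q : S, P * Q = C → φ P * φ Q = D) :
    ∃ α : A, IsUnit α ∧ α ∈ Set.center A ∧
      ∃ Φ : S →ₐ[ℂ] A, ∀ T : S, φ T = α * Φ T := by
  have hS' : ∀ T : X →L[ℂ] X, FRk T → T ∈ S := hS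
  have key := zp_rk1 hX S hS' C hCfin φ D h
  have k1 : ∀ f x R, φ (rk1 hS' f x) * φ R = φ 1 * φ (rk1 hS' f x * R) := by
    intro f x R; simpa using key f x 1 R
  have kc : ∀ f x, φ (rk1 hS' f x) * φ 1 = φ 1 * φ (rk1 hS' f x) := by
    intro f x; simpa using k1 f x 1
  have kT : ∀ f x (T : S), rk1 hS' f x * T = rk1 hS' (f.comp (T : X →L[ℂ] X)) x := by
    intro f x T; apply Subtype.ext; ext y; simp [rk1]
  -- a nonzero rank one element
  obtain ⟨f, x, hfx⟩ : ∃ f x, rk1 hS' f x ≠ 0 := by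
    have : Nontrivial X := by
      by_contra hn
      rw [not_nontrivial_iff_subsingleton] at hn
      exact hX inferInstance
    obtain ⟨x, hx⟩ := exists_ne (0 : X)
    obtain ⟨f, -, hf⟩ := exists_dual_vector ℂ x (norm_ne_zero_iff.2 hx)
    refine ⟨f, x, fun h0 => ?_⟩
    have : f x • x = 0 := congrArg (fun T : S => (T : X →L[ℂ] X) x) h0
    rw [hf] at this
    simp [hx] at this
  have ann : ∀ y, (∀ f x, φ (rk1 hS' f x) * y = 0) → y = 0 := by
    intro y hy
    refine (hprime (φ (rk1 hS' f x)) y fun r => ?_).resolve_left ?_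
    · obtain ⟨T, rfl⟩ := hφ.2 r
      rw [k1, kT, mul_assoc, hy, mul_zero]
    · exact fun h0 => hfx (hφ.1 (by simpa using h0))
  have mulφ : ∀ T R, φ T * φ R = φ 1 * φ (T * R) := by
    intro T R
    refine sub_eq_zero.1 (ann _ fun f x => ?_)
    rw [mul_sub, ← mul_assoc, k1, kT, mul_assoc, k1, ← kT, ← mul_assoc (φ (rk1 hS' f x)), kc,
      mul_assoc (φ 1) (φ (rk1 hS' f x)), k1, mul_assoc (rk1 hS' f x), sub_self]
  have comm : ∀ a, φ 1 * a = a * φ 1 := by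
    intro a
    obtain ⟨T, rfl⟩ := hφ.2 a
    have := mulφ T 1
    rw [mul_one] at this
    exact this.symm
  obtain ⟨T0, hT0⟩ := hφ.2 1
  have inv1 : φ 1 * φ (T0 * T0) = 1 := by rw [← mulφ, hT0, mul_one]
  have inv2 : φ (T0 * T0) * φ 1 = 1 := by rw [← comm, inv1]
  have βc : ∀ a, φ (T0 * T0) * a = a * φ (T0 * T0) := by
    intro a
    calc φ (T0 * T0) * a = φ (T0 * T0) * a * (φ 1 * φ (T0 * T0)) := by rw [inv1, mul_one]
      _ = φ (T0 * T0) * (a * φ 1) * φ (T0 * T0) := by noncomm_ring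
      _ = φ (T0 * T0) * φ 1 * a * φ (T0 * T0) := by rw [← comm]; noncomm_ring
      _ = a * φ (T0 * T0) := by rw [inv2, one_mul]
  refine ⟨φ 1, ⟨⟨φ 1, φ (T0 * T0), inv1, inv2⟩, rfl⟩, ?_, ?_⟩
  · rw [Semigroup.mem_center_iff]
    exact fun a => (comm a).symm
  · refine ⟨AlgHom.ofLinearMap ((LinearMap.mulLeft ℂ (φ (T0 * T0))).comp φ) ?_ ?_, ?_⟩
    · simpa using inv2
    · intro T R
      simp only [LinearMap.comp_apply, LinearMap.mulLeft_apply]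
      calc φ (T0 * T0) * φ (T * R) = φ (T0 * T0) * ((φ (T0 * T0) * φ 1) * φ (T * R)) := by
            rw [inv2, one_mul]
        _ = φ (T0 * T0) * (φ (T0 * T0) * (φ T * φ R)) := by rw [mulφ T R, mul_assoc (φ (T0 * T0))]
        _ = φ (T0 * T0) * ((φ (T0 * T0) * φ T) * φ R) := by rw [mul_assoc (φ (T0 * T0)) (φ T)]
        _ = φ (T0 * T0) * ((φ T * φ (T0 * T0)) * φ R) := by rw [βc (φ T)]
        _ = φ (T0 * T0) * φ T * (φ (T0 * T0) * φ R) := by simp only [mul_assoc]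
    · intro T
      simp only [AlgHom.ofLinearMap_apply, LinearMap.comp_apply, LinearMap.mulLeft_apply]
      rw [← mul_assoc, inv1, one_mul]
end
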